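/- Let k be even, let (c_1,…,c_k) be a P-admissible finite tuple, and set r_k = φ_k(c_1,…,c_k). Then the tuple (c_1,…,c_k,r_k+1) is P-admissible and Sup^{P⁻}(c_1…c_k) = Sup^{P⁻}(c_1…c_k(r_k+1)). -/

import Mathlib

open Filter Finset Topology

/-! `φ` encodes the family of functions: `φ []` is `φ₀` and
`φ [c₁, …, cₙ]` is `φₙ(c₁, …, cₙ)`. Sequences are 0-indexed:
`p 0` is the paper's `p₁`. -/

/-- The list of the first `n` terms of the sequence `p`. -/
def prefixList (p : ℕ → ℕ) (n : ℕ) : List ℕ :=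
  List.ofFn (fun i : Fin n => p i)

/-- A sequence `p` is `P`-admissible if `pₙ ≥ r_{n-1} + 1` for all `n ≥ 1`. -/
def PAdmissibleSeq (φ : List ℕ → ℕ) (p : ℕ → ℕ) : Prop :=
  ∀ n : ℕ, φ (prefixList p n) + 1 ≤ p n

/-- A tuple `(c₁, …, c_k)` (given as the first `k` values of `c`) is `P`-admissible. -/
def PAdmissibleTuple (φ : List ℕ → ℕ) (c : ℕ → ℕ) (k : ℕ) : Prop :=
  ∀ n < k, φ (prefixList c n) + 1 ≤ c n

/-- `r₀ r₁ ⋯ rₙ` where `rᵢ = φᵢ(p₁, …, pᵢ)`. -/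
noncomputable def numer (φ : List ℕ → ℕ) (p : ℕ → ℕ) (n : ℕ) : ℝ :=
  ∏ i ∈ Finset.range (n + 1), (φ (prefixList p i) : ℝ)

/-- `(p₁ − 1)p₁ ⋯ (pₙ − 1)pₙ`. -/
noncomputable def denomBase (p : ℕ → ℕ) (n : ℕ) : ℝ :=
  ∏ j ∈ Finset.range n, (((p j : ℝ) - 1) * (p j : ℝ))

/-- The `P`-value `val_P(p) = Σ_{n=0}^∞ (r₀⋯rₙ)/((p₁−1)p₁⋯(pₙ−1)pₙ·p_{n+1})`. -/
noncomputable def valP (φ : List ℕ → ℕ) (p : ℕ → ℕ) : ℝ :=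
  ∑' n : ℕ, numer φ p n / (denomBase p n * (p n : ℝ))

/-- The `P⁻`-value
`val_{P⁻}(q) = Σ_{n=0}^∞ (−1)ⁿ (r₀⋯rₙ)/((q₁−1)q₁⋯(qₙ−1)qₙ·(q_{n+1}−1))`. -/
noncomputable def valPNeg (φ : List ℕ → ℕ) (q : ℕ → ℕ) : ℝ :=
  ∑' n : ℕ, (-1 : ℝ) ^ n * numer φ q n / (denomBase q n * ((q n : ℝ) - 1))

/-- `Inf^P(c₁…c_k) = Σ_{n=0}^{k−1} (r₀⋯rₙ)/((c₁−1)c₁⋯(cₙ−1)cₙ·c_{n+1})`. -/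
noncomputable def InfP (φ : List ℕ → ℕ) (c : ℕ → ℕ) (k : ℕ) : ℝ :=
  ∑ n ∈ Finset.range k, numer φ c n / (denomBase c n * (c n : ℝ))

/-- The diameter `(r₀⋯r_{k−1})/((c₁−1)c₁⋯(c_k−1)c_k)`. -/
noncomputable def DiamP (φ : List ℕ → ℕ) (c : ℕ → ℕ) (k : ℕ) : ℝ :=
  (∏ i ∈ Finset.range k, (φ (prefixList c i) : ℝ)) / denomBase c k

/-- `Sup^P(c₁…c_k) = Inf^P(c₁…c_k) + (r₀⋯r_{k−1})/((c₁−1)c₁⋯(c_k−1)c_k)`. -/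
noncomputable def SupP (φ : List ℕ → ℕ) (c : ℕ → ℕ) (k : ℕ) : ℝ :=
  InfP φ c k + DiamP φ c k

/-- `A(c₁…c_k) = Σ_{n=0}^{k−1} (−1)ⁿ (r₀⋯rₙ)/((c₁−1)c₁⋯(cₙ−1)cₙ·(c_{n+1}−1))`. -/
noncomputable def APNeg (φ : List ℕ → ℕ) (c : ℕ → ℕ) (k : ℕ) : ℝ :=
  ∑ n ∈ Finset.range k, (-1 : ℝ) ^ n * numer φ c n / (denomBase c n * ((c n : ℝ) - 1))

/-- `Sup^{P⁻}(c₁…c_k)`: `A` if `k` odd, `A + D` if `k` even. -/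
noncomputable def SupPNeg (φ : List ℕ → ℕ) (c : ℕ → ℕ) (k : ℕ) : ℝ :=
  if Odd k then APNeg φ c k else APNeg φ c k + DiamP φ c k

/-- `Inf^{P⁻}(c₁…c_k)`: `A − D` if `k` odd, `A` if `k` even. -/
noncomputable def InfPNeg (φ : List ℕ → ℕ) (c : ℕ → ℕ) (k : ℕ) : ℝ :=
  if Odd k then APNeg φ c k - DiamP φ c k else APNeg φ c k

theorem prefixList_congr {p q : ℕ → ℕ} {n : ℕ} (h : ∀ i < n, p i = q i) :
    prefixList p n = prefixList q n := by
  unfold prefixList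
  congr 1
  funext i
  exact h i i.isLt

theorem prefixList_update_of_le {c : ℕ → ℕ} {k n : ℕ} (h : n ≤ k) (a : ℕ) :
    prefixList (Function.update c k a) n = prefixList c n :=
  prefixList_congr fun i hi => Function.update_of_ne (by omega) a c

theorem numer_update_of_le (φ : List ℕ → ℕ) {c : ℕ → ℕ} {k n : ℕ} (h : n ≤ k) (a : ℕ) :
    numer φ (Function.update c k a) n = numer φ c n := by
  refine Finset.prod_congr rfl fun i hi => ?_
  rw [prefixList_update_of_le (by have := Finset.mem_range.1 hi; omega)]

theorem denomBase_update_of_le {c : ℕ → ℕ} {k n : ℕ} (h : n ≤ k) (a : ℕ) :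
    denomBase (Function.update c k a) n = denomBase c n := by
  refine Finset.prod_congr rfl fun j hj => ?_
  rw [Function.update_of_ne (by have := Finset.mem_range.1 hj; omega)]

theorem APNeg_update (φ : List ℕ → ℕ) (c : ℕ → ℕ) (k a : ℕ) :
    APNeg φ (Function.update c k a) k = APNeg φ c k := by
  refine Finset.sum_congr rfl fun n hn => ?_
  have hn := Finset.mem_range.1 hn
  rw [numer_update_of_le φ hn.le, denomBase_update_of_le hn.le, Function.update_of_ne hn.ne]

theorem APNeg_succ (φ : List ℕ → ℕ) (c : ℕ → ℕ) (k : ℕ) :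
    APNeg φ c (k + 1) =
      APNeg φ c k + (-1 : ℝ) ^ k * numer φ c k / (denomBase c k * ((c k : ℝ) - 1)) :=
  Finset.sum_range_succ _ _

theorem PAdmissibleTuple.update {φ : List ℕ → ℕ} {c : ℕ → ℕ} {k a : ℕ}
    (hc : PAdmissibleTuple φ c k) (ha : φ (prefixList c k) + 1 ≤ a) :
    PAdmissibleTuple φ (Function.update c k a) (k + 1) := by
  intro n hn
  rw [prefixList_update_of_le (Nat.lt_succ_iff.1 hn)]
  rcases Nat.lt_succ_iff_lt_or_eq.1 hn with h | rfl
  · rw [Function.update_of_ne h.ne]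
    exact hc n h
  · rwa [Function.update_self]

/-- for even `k`,
`Sup^{P⁻}(c₁…c_k) = Sup^{P⁻}(c₁…c_k(r_k+1))` where `r_k = φ_k(c₁,…,c_k)`. -/
theorem stmt15 (φ : List ℕ → ℕ) (hφ : ∀ l, 0 < φ l)
    (k : ℕ) (hk : Even k) (c : ℕ → ℕ) (hc : PAdmissibleTuple φ c k) :
    PAdmissibleTuple φ (Function.update c k (φ (prefixList c k) + 1)) (k + 1) ∧
      SupPNeg φ c k =
        SupPNeg φ (Function.update c k (φ (prefixList c k) + 1)) (k + 1) := by
  refine ⟨hc.update le_rfl, ?_⟩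
  have hr : (φ (prefixList c k) : ℝ) ≠ 0 := Nat.cast_ne_zero.2 (hφ _).ne'
  rw [SupPNeg, SupPNeg, if_neg (Nat.not_odd_iff_even.2 hk), if_pos hk.add_one, APNeg_succ,
    APNeg_update, numer_update_of_le φ le_rfl, denomBase_update_of_le le_rfl,
    Function.update_self, hk.neg_one_pow, one_mul, Nat.cast_add_one, add_sub_cancel_right,
    numer, Finset.prod_range_succ, mul_div_mul_right _ _ hr, DiamP]
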